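/- For every β ≥ 0 and every L ≥ 1 one has Z^{NE,*}_{β,L−1} ≤ Z̃^{NE,*}_{β,L} ≤ Z^{NE,*}_{β,L}. Consequently the limit F^{NE,*}(β) := lim_{L→∞} (1/L) log Z^{NE,*}_{β,L} exists and equals F̃^{NE,*}(β) := lim_{L→∞} (1/L) log Z̃^{NE,*}_{β,L}. -/

import Mathlib

open Filter

/-! ## Paths on `ℤ²` encoded by direction sequences -/

/-- The four unit steps of `ℤ²`: right, left, up, down. -/
def dirs : Fin 4 → ℤ × ℤ := ![(1, 0), (-1, 0), (0, 1), (0, -1)]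

/-- The list of steps (increments) of an `L`-step path encoded by a direction sequence. -/
def stepsOf {L : ℕ} (s : Fin L → Fin 4) : List (ℤ × ℤ) := (List.ofFn s).map dirs

/-- The position `w_i` of the path after `i` steps; `w_0 = (0,0)`. -/
def pt (steps : List (ℤ × ℤ)) (i : ℕ) : ℤ × ℤ := (steps.take i).sum

/-- Self-avoiding: the sites `w_0, …, w_L` are pairwise distinct. -/
def IsSA (steps : List (ℤ × ℤ)) : Prop :=
  ∀ i ≤ steps.length, ∀ j ≤ steps.length, pt steps i = pt steps j → i = j

/-- Prudent: no step points towards a previously visited site, i.e. for every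
`i < L`, every `k ≥ 1` and every `j ≤ i`, `w_i + k (w_{i+1} - w_i) ≠ w_j`. -/
def IsPrudent (steps : List (ℤ × ℤ)) : Prop :=
  ∀ i < steps.length, ∀ k : ℕ, 1 ≤ k → ∀ j ≤ i,
    pt steps i + (k : ℤ) • steps.getD i (0, 0) ≠ pt steps j

/-- Twice the midpoint `u_{i+1}` of step number `i` (0-indexed): `w_i + w_{i+1}`. -/
def dmid (steps : List (ℤ × ℤ)) (i : ℕ) : ℤ × ℤ := pt steps i + pt steps (i + 1)

/-- The Hamiltonian `H(w)`: the number of pairs `1 ≤ i < j ≤ L` with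
`‖u_i - u_j‖ = 1`, i.e. whose doubled midpoints differ by a vector of squared
Euclidean norm `4`. -/
noncomputable def Ham (steps : List (ℤ × ℤ)) : ℕ :=
  ((Finset.range steps.length ×ˢ Finset.range steps.length).filter fun p =>
      p.1 < p.2 ∧ (dmid steps p.1 - dmid steps p.2).1 ^ 2 +
        (dmid steps p.1 - dmid steps p.2).2 ^ 2 = 4).card

/-! ## IPSAW -/

open scoped Classical in
/-- `Ω_L^PSAW`: the set of `L`-step prudent paths. -/
noncomputable def psawFinset (L : ℕ) : Finset (Fin L → Fin 4) :=
  Finset.univ.filter fun s => IsPrudent (stepsOf s)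

/-- `Z_{β,L}`: the partition function of IPSAW. -/
noncomputable def Zpsaw (β : ℝ) (L : ℕ) : ℝ :=
  ∑ s ∈ psawFinset L, Real.exp (β * (Ham (stepsOf s) : ℝ))

/-! ## Partially directed paths, oriented blocks and NE-prudent paths -/

/-- The vertical run of steps corresponding to a (signed) stretch `ℓ`. -/
def vrun (ℓ : ℤ) : List (ℤ × ℤ) := List.replicate ℓ.natAbs (if 0 ≤ ℓ then (0, 1) else (0, -1))

/-- The horizontal run of steps corresponding to a (signed) stretch `ℓ`. -/
def hrun (ℓ : ℤ) : List (ℤ × ℤ) := List.replicate ℓ.natAbs (if 0 ≤ ℓ then (1, 0) else (-1, 0))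

/-- The west-east partially directed path with stretch sequence `ℓs`: vertical
runs separated by single horizontal inter-stretch steps. -/
def weSteps (ℓs : List ℤ) : List (ℤ × ℤ) := List.intercalate [(1, 0)] (ℓs.map vrun)

/-- The south-north partially directed path with stretch sequence `ℓs`: horizontal
runs separated by single vertical inter-stretch steps. -/
def snSteps (ℓs : List ℤ) : List (ℤ × ℤ) := List.intercalate [(0, 1)] (ℓs.map hrun)

/-- The upper exit condition: `ℓ_1 + ⋯ + ℓ_N > max_{0 ≤ i < N} (ℓ_1 + ⋯ + ℓ_i)`. -/
def upperExit (ℓs : List ℤ) : Prop := ∀ i < ℓs.length, (ℓs.take i).sum < ℓs.sum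

/-- A block of given type: `true` = west-east, `false` = south-north. -/
def blockSteps : Bool → List ℤ → List (ℤ × ℤ)
  | true, ℓs => weSteps ℓs
  | false, ℓs => snSteps ℓs

/-- The concatenation of a sequence of blocks of alternating type, starting with
type `b`. -/
def neSteps : Bool → List (List ℤ) → List (ℤ × ℤ)
  | _, [] => []
  | b, ℓs :: rest => blockSteps b ℓs ++ neSteps (!b) rest

/-- Block data of an NE-prudent path: a nonempty sequence of nonempty stretch
sequences, all blocks but the last satisfying the upper exit condition, and all
blocks but the first having a negative first stretch. -/
def IsNEData (bs : List (List ℤ)) : Prop :=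
  bs ≠ [] ∧ (∀ ℓs ∈ bs, ℓs ≠ []) ∧
  (∀ i : ℕ, i + 1 < bs.length → upperExit (bs.getD i [])) ∧
  (∀ i : ℕ, 0 < i → i < bs.length → (bs.getD i []).headI < 0)

/-- An NE-prudent path: a prudent path obtained as the concatenation of oriented
blocks of alternating type as prescribed by `IsNEData`. -/
def IsNEPath (steps : List (ℤ × ℤ)) : Prop :=
  IsPrudent steps ∧ ∃ (b : Bool) (bs : List (List ℤ)), IsNEData bs ∧ neSteps b bs = steps

open scoped Classical in
/-- `Ω_L^NE`: the set of `L`-step NE-prudent paths. -/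
noncomputable def neFinset (L : ℕ) : Finset (Fin L → Fin 4) :=
  Finset.univ.filter fun s => IsNEPath (stepsOf s)

/-- `Z^NE_{β,L}`: the partition function of NE-IPSAW. -/
noncomputable def Zne (β : ℝ) (L : ℕ) : ℝ :=
  ∑ s ∈ neFinset L, Real.exp (β * (Ham (stepsOf s) : ℝ))

/-! ## Starred and tilde NE sets -/

/-- Block data where all blocks, including the last one, satisfy the upper exit
condition. -/
def IsNEStarData (bs : List (List ℤ)) : Prop :=
  bs ≠ [] ∧ (∀ ℓs ∈ bs, ℓs ≠ []) ∧
  (∀ i : ℕ, i < bs.length → upperExit (bs.getD i [])) ∧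
  (∀ i : ℕ, 0 < i → i < bs.length → (bs.getD i []).headI < 0)

/-- Membership in `Ω_L^{NE,*}`. -/
def IsNEStar (steps : List (ℤ × ℤ)) : Prop :=
  IsPrudent steps ∧ ∃ (b : Bool) (bs : List (List ℤ)), IsNEStarData bs ∧ neSteps b bs = steps

/-- Membership in `Ω̃_L^{NE,*}`: moreover the first stretch of the path has length `0`. -/
def IsNETilde (steps : List (ℤ × ℤ)) : Prop :=
  IsPrudent steps ∧ ∃ (b : Bool) (bs : List (List ℤ)), IsNEStarData bs ∧
    bs.headI.headI = 0 ∧ neSteps b bs = steps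

open scoped Classical in
noncomputable def neStarFinset (L : ℕ) : Finset (Fin L → Fin 4) :=
  Finset.univ.filter fun s => IsNEStar (stepsOf s)

open scoped Classical in
noncomputable def neTildeFinset (L : ℕ) : Finset (Fin L → Fin 4) :=
  Finset.univ.filter fun s => IsNETilde (stepsOf s)

/-- `Z^{NE,*}_{β,L}`. -/
noncomputable def Zstar (β : ℝ) (L : ℕ) : ℝ :=
  ∑ s ∈ neStarFinset L, Real.exp (β * (Ham (stepsOf s) : ℝ))

/-- `Z̃^{NE,*}_{β,L}`. -/
noncomputable def Ztilde (β : ℝ) (L : ℕ) : ℝ :=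
  ∑ s ∈ neTildeFinset L, Real.exp (β * (Ham (stepsOf s) : ℝ))

/-! ## IPDSAW and ISAW -/

/-- A west-east partially directed self-avoiding path: increments in
`{(1,0),(0,1),(0,-1)}` and self-avoiding. -/
def IsPD (steps : List (ℤ × ℤ)) : Prop :=
  (∀ d ∈ steps, d = (1, 0) ∨ d = (0, 1) ∨ d = (0, -1)) ∧ IsSA steps

open scoped Classical in
/-- `Ω_L^PDSAW`. -/
noncomputable def pdFinset (L : ℕ) : Finset (Fin L → Fin 4) :=
  Finset.univ.filter fun s => IsPD (stepsOf s)

/-- `Z^IPDSAW_{β,L}`. -/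
noncomputable def Zipd (β : ℝ) (L : ℕ) : ℝ :=
  ∑ s ∈ pdFinset L, Real.exp (β * (Ham (stepsOf s) : ℝ))

open scoped Classical in
/-- `Ω_L^SAW`. -/
noncomputable def sawFinset (L : ℕ) : Finset (Fin L → Fin 4) :=
  Finset.univ.filter fun s => IsSA (stepsOf s)

/-- `Z^ISAW_{β,L}`. -/
noncomputable def Zisaw (β : ℝ) (L : ℕ) : ℝ :=
  ∑ s ∈ sawFinset L, Real.exp (β * (Ham (stepsOf s) : ℝ))

/-! ## Orientations of two-sided paths -/

/-- The four possible general orientations of a two-sided prudent path. -/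
inductive Orient | NE | NW | SE | SW
deriving DecidableEq

/-- The axial symmetry of `ℤ²` turning an NE-oriented object into an
`x`-oriented one, acting on steps. -/
def osym : Orient → ℤ × ℤ → ℤ × ℤ
  | Orient.NE, d => d
  | Orient.NW, d => (-d.1, d.2)
  | Orient.SE, d => (d.1, -d.2)
  | Orient.SW, d => (-d.1, -d.2)

/-! ## Sites of a path -/

theorem pt_of_length_le {l : List (ℤ × ℤ)} {i : ℕ} (h : l.length ≤ i) : pt l i = l.sum := by
  rw [pt, List.take_of_length_le h]

theorem pt_append_of_le {l m : List (ℤ × ℤ)} {i : ℕ} (h : i ≤ l.length) :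
    pt (l ++ m) i = pt l i := by
  rw [pt, pt, List.take_append_of_le_length h]

theorem pt_append_length_add (l m : List (ℤ × ℤ)) (i : ℕ) :
    pt (l ++ m) (l.length + i) = l.sum + pt m i := by
  simp [pt, List.take_append, List.take_of_length_le (Nat.le_add_right l.length i)]

theorem forall_pt_append_singleton {R : ℤ × ℤ → Prop} {l : List (ℤ × ℤ)} {d : ℤ × ℤ}
    (hl : ∀ i, R (pt l i)) (hd : R (l.sum + d)) (i : ℕ) : R (pt (l ++ [d]) i) := by
  rcases le_or_gt i l.length with h | h
  · rw [pt_append_of_le h]; exact hl i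
  · rw [pt_of_length_le (by simpa using h)]; simpa using hd

theorem sum_map_swap (l : List (ℤ × ℤ)) : (l.map Prod.swap).sum = l.sum.swap := by
  induction l with
  | nil => rfl
  | cons a l ih => simp [ih]

theorem pt_map_swap (l : List (ℤ × ℤ)) (i : ℕ) : pt (l.map Prod.swap) i = (pt l i).swap := by
  rw [pt, pt, ← List.map_take, sum_map_swap]

theorem map_swap_map_swap (l : List (ℤ × ℤ)) : (l.map Prod.swap).map Prod.swap = l := by
  simp

/-! ## Prudence -/

theorem isPrudent_nil : IsPrudent [] := by
  intro i hi; simp at hi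

theorem IsPrudent.append_singleton {l : List (ℤ × ℤ)} {d : ℤ × ℤ} (hl : IsPrudent l)
    (hd : ∀ k : ℕ, 1 ≤ k → ∀ j, l.sum + (k : ℤ) • d ≠ pt l j) : IsPrudent (l ++ [d]) := by
  intro i hi k hk j hj
  rw [List.length_append, List.length_singleton] at hi
  rcases Nat.lt_succ_iff_lt_or_eq.mp hi with h | rfl
  · rw [pt_append_of_le h.le, pt_append_of_le (hj.trans h.le), List.getD_append _ _ _ _ h]
    exact hl i h k hk j hj
  · rw [pt_append_of_le le_rfl, pt_append_of_le hj, pt_of_length_le le_rfl,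
      List.getD_append_right _ _ _ _ le_rfl]
    simpa using hd k hk j

theorem IsPrudent.map_swap {l : List (ℤ × ℤ)} (hl : IsPrudent l) :
    IsPrudent (l.map Prod.swap) := by
  intro i hi k hk j hj h
  rw [List.length_map] at hi
  refine hl i hi k hk j hj ?_
  rw [pt_map_swap, pt_map_swap] at h
  rw [List.getD_eq_getElem _ _ hi]
  rw [List.getD_eq_getElem _ _ (by simpa using hi), List.getElem_map] at h
  apply Prod.swap_injective
  rw [← h]
  rfl

/-- A vertical run in direction `s = ±1` out of a path all of whose sites in the final column lie
behind its endpoint. -/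
theorem IsPrudent.append_vertical {s : ℤ} (hs : s = 1 ∨ s = -1) (n : ℕ) {l : List (ℤ × ℤ)}
    (hl : IsPrudent l)
    (hbehind : ∀ i, (pt l i).1 < l.sum.1 ∨ (pt l i).1 = l.sum.1 ∧ (pt l i).2 * s ≤ l.sum.2 * s) :
    IsPrudent (l ++ List.replicate n (0, s)) := by
  induction n generalizing l with
  | zero => simpa using hl
  | succ n ih =>
    rw [List.replicate_succ, ← List.singleton_append, ← List.append_assoc]
    have hs2 : s * s = 1 := by rcases hs with rfl | rfl <;> rfl
    apply ih
    · refine hl.append_singleton fun k hk j h => ?_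
      have h1 := congrArg Prod.fst h
      have h2 := congrArg Prod.snd h
      simp only [Prod.fst_add, Prod.snd_add, Prod.smul_fst, Prod.smul_snd, smul_eq_mul] at h1 h2
      rcases hbehind j with hj | ⟨-, hj⟩
      · omega
      · rw [← h2] at hj
        have : (1 : ℤ) ≤ k := by exact_mod_cast hk
        nlinarith
    · have hsum : (l ++ [(0, s)]).sum = (l.sum.1, l.sum.2 + s) := by simp [Prod.ext_iff]
      rw [hsum]
      refine forall_pt_append_singleton (R := fun q => q.1 < l.sum.1 ∨
        q.1 = l.sum.1 ∧ q.2 * s ≤ (l.sum.2 + s) * s) (fun i => ?_) (by simp)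
      rcases hbehind i with hi | ⟨hi, hi'⟩
      · exact Or.inl hi
      · right; rw [add_mul, hs2]; omega

theorem forall_pt_append_replicate {R : ℤ × ℤ → Prop} {d : ℤ × ℤ} {l : List (ℤ × ℤ)} {n : ℕ}
    (hl : ∀ i, R (pt l i)) (hd : ∀ m ≤ n, R (l.sum + m • d)) (i : ℕ) :
    R (pt (l ++ List.replicate n d) i) := by
  rcases le_or_gt i l.length with h | h
  · rw [pt_append_of_le h]; exact hl i
  · obtain ⟨j, rfl⟩ := Nat.exists_eq_add_of_le h.le
    rw [pt_append_length_add, pt, List.take_replicate, List.sum_replicate]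
    exact hd _ (min_le_right _ _)

theorem sum_vrun (a : ℤ) : (vrun a).sum = (0, a) := by
  unfold vrun
  split_ifs with h
  · simp [abs_of_nonneg h]
  · simp [abs_of_neg (not_le.mp h)]

/-- All sites other than the endpoint lie in strictly earlier columns. -/
def FreshColumn (l : List (ℤ × ℤ)) : Prop := ∀ i, pt l i = l.sum ∨ (pt l i).1 < l.sum.1

theorem FreshColumn.isPrudent_append_vrun {l : List (ℤ × ℤ)} (hl : IsPrudent l)
    (hf : FreshColumn l) (a : ℤ) : IsPrudent (l ++ vrun a) := by
  have hbehind (s : ℤ) (i : ℕ) : (pt l i).1 < l.sum.1 ∨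
      (pt l i).1 = l.sum.1 ∧ (pt l i).2 * s ≤ l.sum.2 * s := by
    rcases hf i with h | h
    · right; simp [h]
    · exact Or.inl h
  unfold vrun
  split_ifs
  · exact hl.append_vertical (Or.inl rfl) _ (hbehind 1)
  · exact hl.append_vertical (Or.inr rfl) _ (hbehind (-1))

theorem forall_pt_append_vrun {R : ℤ × ℤ → Prop} {l : List (ℤ × ℤ)} {a : ℤ}
    (hl : ∀ i, R (pt l i))
    (hd : ∀ y, min 0 a ≤ y → y ≤ max 0 a → R (l.sum.1, l.sum.2 + y)) (i : ℕ) :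
    R (pt (l ++ vrun a) i) := by
  unfold vrun
  refine forall_pt_append_replicate hl (fun m hm => ?_) i
  split_ifs
  · convert hd m (by omega) (by omega) using 1
    ext <;> simp
  · convert hd (-m) (by omega) (by omega) using 1
    ext <;> simp

theorem FreshColumn.append_vrun_east {l : List (ℤ × ℤ)} (hf : FreshColumn l) (a : ℤ) :
    FreshColumn (l ++ vrun a ++ [(1, 0)]) := by
  refine forall_pt_append_singleton (R := fun q => q = (l ++ vrun a ++ [(1, 0)]).sum ∨
    q.1 < (l ++ vrun a ++ [(1, 0)]).sum.1) ?_ ?_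
  · refine forall_pt_append_vrun (R := fun q => q = (l ++ vrun a ++ [(1, 0)]).sum ∨
      q.1 < (l ++ vrun a ++ [(1, 0)]).sum.1) ?_ ?_
    · intro i
      right
      rcases hf i with h | h
      · simp [sum_vrun, h]
      · simp [sum_vrun]; omega
    · intro y _ _
      right
      simp [sum_vrun]
  · left; simp [add_assoc]

theorem FreshColumn.fst_le {l : List (ℤ × ℤ)} (hf : FreshColumn l) (i : ℕ) :
    (pt l i).1 ≤ l.sum.1 := by
  rcases hf i with h | h
  · rw [h]
  · exact h.le

theorem FreshColumn.fst_le_append_vrun {l : List (ℤ × ℤ)} (hf : FreshColumn l) (a : ℤ) (i : ℕ) :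
    (pt (l ++ vrun a) i).1 ≤ (l ++ vrun a).sum.1 := by
  refine forall_pt_append_vrun (R := fun q => q.1 ≤ (l ++ vrun a).sum.1) (fun i => ?_)
    (fun y _ _ => ?_) i
  · simpa [sum_vrun] using hf.fst_le i
  · simp [sum_vrun]

theorem weSteps_singleton (a : ℤ) : weSteps [a] = vrun a := by
  simp [weSteps]

theorem weSteps_cons_cons (a b : ℤ) (r : List ℤ) :
    weSteps (a :: b :: r) = vrun a ++ (1, 0) :: weSteps (b :: r) := by
  simp [weSteps, List.intercalate_cons_cons]

theorem upperExit.tail {a b : ℤ} {r : List ℤ} (h : upperExit (a :: b :: r)) :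
    upperExit (b :: r) := by
  intro i hi
  have := h (i + 1) (by simpa using hi)
  simpa using this

/-- A west-east block with the upper exit condition, appended to a path in a fresh column, keeps
the path prudent and ends in a fresh row. -/
theorem FreshColumn.append_weSteps {ℓs : List ℤ} (hne : ℓs ≠ []) (hex : upperExit ℓs)
    {l : List (ℤ × ℤ)} (hl : IsPrudent l) (hf : FreshColumn l)
    (hlow : ∀ i, (pt l i).2 < l.sum.2 + ℓs.sum) :
    IsPrudent (l ++ weSteps ℓs) ∧ FreshColumn ((l ++ weSteps ℓs).map Prod.swap) ∧
      ∀ i, (pt (l ++ weSteps ℓs) i).1 ≤ (l ++ weSteps ℓs).sum.1 := by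
  induction ℓs generalizing l with
  | nil => exact absurd rfl hne
  | cons a r ih =>
    have hpos := hex 0 (by simp)
    cases r with
    | nil =>
      rw [weSteps_singleton]
      refine ⟨hf.isPrudent_append_vrun hl a, fun i => ?_, hf.fst_le_append_vrun a⟩
      simp only [List.sum_cons, List.sum_nil, List.take_zero, add_zero] at hlow hpos
      rw [pt_map_swap, sum_map_swap, Prod.swap_inj]
      refine forall_pt_append_vrun (R := fun q => q = (l ++ vrun a).sum ∨
        q.swap.1 < (l ++ vrun a).sum.swap.1) (fun i => ?_) (fun y _ _ => ?_) i
      · right; simpa [sum_vrun] using hlow i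
      · rcases eq_or_ne y a with rfl | hy
        · left; simp [sum_vrun, Prod.ext_iff]
        · right; simp [sum_vrun]; omega
    | cons b r =>
      have hstep := hex 1 (by simp)
      rw [weSteps_cons_cons, ← List.append_assoc, ← List.singleton_append, ← List.append_assoc]
      refine ih (by simp) hex.tail ?_ (hf.append_vrun_east a) ?_
      · refine (hf.isPrudent_append_vrun hl a).append_singleton fun k hk j h => ?_
        have h1 := congrArg Prod.fst h
        have h2 := hf.fst_le_append_vrun a j
        simp only [Prod.fst_add, Prod.smul_fst, smul_eq_mul] at h1
        omega
      · simp only [List.sum_cons, List.take_zero, List.sum_nil, List.take_succ_cons] at *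
        refine forall_pt_append_singleton
          (R := fun q => q.2 < (l ++ vrun a ++ [(1, 0)]).sum.2 + (b + r.sum)) ?_ ?_
        · refine forall_pt_append_vrun
            (R := fun q => q.2 < (l ++ vrun a ++ [(1, 0)]).sum.2 + (b + r.sum))
            (fun i => ?_) (fun y _ _ => ?_)
          · have := hlow i
            simp [sum_vrun]; omega
          · simp [sum_vrun]; omega
        · simp [sum_vrun]; omega

theorem map_swap_vrun (a : ℤ) : (vrun a).map Prod.swap = hrun a := by
  unfold vrun hrun
  split_ifs <;> simp

theorem map_swap_weSteps (ℓs : List ℤ) : (weSteps ℓs).map Prod.swap = snSteps ℓs := by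
  induction ℓs with
  | nil => rfl
  | cons a r ih =>
    cases r with
    | nil => simp [weSteps, snSteps, map_swap_vrun]
    | cons b r =>
      simp only [weSteps, snSteps, List.map_cons, List.intercalate_cons_cons, List.map_append,
        map_swap_vrun] at ih ⊢
      rw [ih]
      rfl

theorem map_swap_blockSteps (b : Bool) (ℓs : List ℤ) :
    (blockSteps b ℓs).map Prod.swap = blockSteps (!b) ℓs := by
  cases b
  · simp [blockSteps, ← map_swap_weSteps]
  · exact map_swap_weSteps ℓs

theorem map_swap_neSteps (b : Bool) (bs : List (List ℤ)) :
    (neSteps b bs).map Prod.swap = neSteps (!b) bs := by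
  induction bs generalizing b with
  | nil => rfl
  | cons ℓs bs ih => simp [neSteps, map_swap_blockSteps, ih]

theorem FreshColumn.isPrudent_append_neSteps {bs : List (List ℤ)}
    (hbs : ∀ ℓs ∈ bs, ℓs ≠ [] ∧ upperExit ℓs) {l : List (ℤ × ℤ)} (hl : IsPrudent l)
    (hf : FreshColumn l) (hlow : ∀ i, (pt l i).2 ≤ l.sum.2) :
    IsPrudent (l ++ neSteps true bs) := by
  induction bs generalizing l with
  | nil => simpa [neSteps] using hl
  | cons ℓs bs ih =>
    obtain ⟨hne, hex⟩ := hbs ℓs (by simp)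
    have hpos : 0 < ℓs.sum := by simpa using hex 0 (List.length_pos_of_ne_nil hne)
    obtain ⟨hp, hf', hle⟩ := FreshColumn.append_weSteps hne hex hl hf
      fun i => by have := hlow i; omega
    have := (ih (fun m hm => hbs m (by simp [hm])) hp.map_swap hf'
      fun i => by rw [pt_map_swap, sum_map_swap]; exact hle i).map_swap
    rw [List.map_append, map_swap_map_swap, map_swap_neSteps, List.append_assoc] at this
    exact this

theorem isPrudent_neSteps (b : Bool) {bs : List (List ℤ)}
    (hbs : ∀ ℓs ∈ bs, ℓs ≠ [] ∧ upperExit ℓs) : IsPrudent (neSteps b bs) := by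
  have h : IsPrudent (neSteps true bs) :=
    FreshColumn.isPrudent_append_neSteps (l := []) hbs isPrudent_nil
      (fun i => Or.inl (by simp [pt])) (fun i => by simp [pt])
  cases b
  · simpa [map_swap_neSteps] using h.map_swap
  · exact h

/-! ## Block data -/

theorem isNEStarData_iff {bs : List (List ℤ)} : IsNEStarData bs ↔
    bs ≠ [] ∧ (∀ ℓs ∈ bs, ℓs ≠ [] ∧ upperExit ℓs) ∧ ∀ ℓs ∈ bs.tail, ℓs.headI < 0 := by
  unfold IsNEStarData
  refine and_congr_right fun hne => ?_
  obtain ⟨ℓs, r, rfl⟩ := List.exists_cons_of_ne_nil hne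
  constructor
  · rintro ⟨h1, h2, h3⟩
    refine ⟨fun m hm => ⟨h1 m hm, ?_⟩, fun m hm => ?_⟩
    · obtain ⟨i, hi, rfl⟩ := List.getElem_of_mem hm
      exact List.getD_eq_getElem _ [] hi ▸ h2 i hi
    · obtain ⟨i, hi, rfl⟩ := List.getElem_of_mem hm
      have hi' : i < r.length := by simpa using hi
      simpa [List.getElem?_eq_getElem hi'] using h3 (i + 1) (by simp) (by simpa using hi')
  · rintro ⟨h1, h2⟩
    refine ⟨fun m hm => (h1 m hm).1, fun i hi => ?_, fun i h0 hi => ?_⟩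
    · rw [List.getD_eq_getElem _ _ hi]
      exact (h1 _ (List.getElem_mem hi)).2
    · rw [List.getD_eq_getElem _ _ hi]
      obtain ⟨j, rfl⟩ := Nat.exists_eq_succ_of_ne_zero h0.ne'
      exact h2 _ (List.getElem_mem (l := r) (by simpa using hi))

theorem IsNEStarData.isPrudent {bs : List (List ℤ)} (h : IsNEStarData bs) (b : Bool) :
    IsPrudent (neSteps b bs) :=
  isPrudent_neSteps b (isNEStarData_iff.mp h).2.1

theorem upperExit.sum_pos {ℓs : List ℤ} (h : upperExit ℓs) (hne : ℓs ≠ []) : 0 < ℓs.sum := by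
  simpa using h 0 (List.length_pos_of_ne_nil hne)

theorem upperExit.append {ℓs ms : List ℤ} (hℓ : upperExit ℓs) (hm : upperExit ms)
    (hne : ms ≠ []) : upperExit (ℓs ++ ms) := by
  intro i hi
  have hpos := hm.sum_pos hne
  rw [List.take_append, List.sum_append, List.sum_append]
  rcases lt_or_ge i ℓs.length with h | h
  · have := hℓ i h
    rw [Nat.sub_eq_zero_of_le h.le]
    simp only [List.take_zero, List.sum_nil]
    omega
  · rw [List.take_of_length_le h]
    have := hm (i - ℓs.length) (by rw [List.length_append] at hi; omega)
    omega

theorem upperExit.zero_cons {ℓs : List ℤ} (h : upperExit ℓs) (hne : ℓs ≠ []) :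
    upperExit (0 :: ℓs) := by
  intro i hi
  rcases i with _ | i
  · simpa using h.sum_pos hne
  · simpa using h i (by simpa using hi)

theorem upperExit.of_zero_cons {ℓs : List ℤ} (h : upperExit (0 :: ℓs)) :
    ℓs ≠ [] ∧ upperExit ℓs := by
  refine ⟨?_, fun i hi => ?_⟩
  · rintro rfl
    simpa using h 0 (by simp)
  · simpa using h (i + 1) (by simpa using hi)

theorem weSteps_zero_cons {ℓs : List ℤ} (hne : ℓs ≠ []) :
    weSteps (0 :: ℓs) = (1, 0) :: weSteps ℓs := by
  obtain ⟨a, r, rfl⟩ := List.exists_cons_of_ne_nil hne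
  simp [weSteps_cons_cons, vrun]

theorem weSteps_append {ℓs ms : List ℤ} (hℓ : ℓs ≠ []) (hm : ms ≠ []) :
    weSteps (ℓs ++ ms) = weSteps ℓs ++ weSteps (0 :: ms) := by
  rw [weSteps_zero_cons hm]
  obtain ⟨b, s, rfl⟩ := List.exists_cons_of_ne_nil hm
  induction ℓs with
  | nil => exact absurd rfl hℓ
  | cons a r ih =>
    cases r with
    | nil => simp [weSteps_cons_cons, weSteps_singleton]
    | cons a' r =>
      have := ih (by simp)
      simp only [List.cons_append, weSteps_cons_cons, List.append_assoc] at this ⊢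
      rw [this]

theorem blockSteps_append (b : Bool) {ℓs ms : List ℤ} (hℓ : ℓs ≠ []) (hm : ms ≠ []) :
    blockSteps b (ℓs ++ ms) = blockSteps b ℓs ++ blockSteps b (0 :: ms) := by
  have h : blockSteps true (ℓs ++ ms) = blockSteps true ℓs ++ blockSteps true (0 :: ms) :=
    weSteps_append hℓ hm
  cases b
  · have := congrArg (List.map Prod.swap) h
    simpa only [List.map_append, map_swap_blockSteps, Bool.not_true] using this
  · exact h

/-- The step joining two consecutive stretches of a block of type `b`. -/
def interStep (b : Bool) : ℤ × ℤ := if b then (1, 0) else (0, 1)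

theorem blockSteps_zero_cons (b : Bool) {ℓs : List ℤ} (hne : ℓs ≠ []) :
    blockSteps b (0 :: ℓs) = interStep b :: blockSteps b ℓs := by
  have h : blockSteps true (0 :: ℓs) = interStep true :: blockSteps true ℓs :=
    weSteps_zero_cons hne
  cases b
  · have := congrArg (List.map Prod.swap) h
    rwa [List.map_cons, map_swap_blockSteps, map_swap_blockSteps] at this
  · exact h

/-- Block data whose first stretch has length `0` can be merged into the last block of any block
data, provided the types match. -/
theorem IsNEStarData.exists_merge {bs : List (List ℤ)} (hbs : IsNEStarData bs) (b : Bool) :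
    ∃ b' : Bool, ∀ cs, IsNEStarData cs → cs.headI.headI = 0 →
      ∃ ds, IsNEStarData ds ∧ ds.headI.headI = bs.headI.headI ∧
        neSteps b ds = neSteps b bs ++ neSteps b' cs := by
  induction bs generalizing b with
  | nil => exact absurd rfl hbs.1
  | cons ℓs r ih =>
    rw [isNEStarData_iff] at hbs
    obtain ⟨-, hall, hneg⟩ := hbs
    obtain ⟨hℓ, hex⟩ := hall ℓs (by simp)
    cases r with
    | nil =>
      refine ⟨b, fun cs hcs hzero => ?_⟩
      rw [isNEStarData_iff] at hcs
      obtain ⟨hcne, hcall, hcneg⟩ := hcs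
      obtain ⟨ms, cs, rfl⟩ := List.exists_cons_of_ne_nil hcne
      obtain ⟨hm, hmex⟩ := hcall ms (by simp)
      obtain ⟨z, ms, rfl⟩ := List.exists_cons_of_ne_nil hm
      obtain rfl : z = 0 := hzero
      obtain ⟨hmne, hmex⟩ := hmex.of_zero_cons
      refine ⟨(ℓs ++ ms) :: cs, isNEStarData_iff.mpr ⟨by simp, ?_, hcneg⟩, ?_, ?_⟩
      · intro x hx
        rcases List.mem_cons.mp hx with rfl | hx
        · exact ⟨by simp [hℓ], hex.append hmex hmne⟩
        · exact hcall x (List.mem_cons_of_mem _ hx)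
      · obtain ⟨a, t, rfl⟩ := List.exists_cons_of_ne_nil hℓ
        rfl
      · simp [neSteps, blockSteps_append b hℓ hmne]
    | cons ms r =>
      have hr : IsNEStarData (ms :: r) := isNEStarData_iff.mpr ⟨by simp,
        fun x hx => hall x (List.mem_cons_of_mem _ hx),
        fun x hx => hneg x (List.mem_of_mem_tail hx)⟩
      obtain ⟨b', hb'⟩ := ih hr (!b)
      refine ⟨b', fun cs hcs hzero => ?_⟩
      obtain ⟨ds, hds, hhead, hsteps⟩ := hb' cs hcs hzero
      rw [isNEStarData_iff] at hds
      obtain ⟨hdne, hdall, hdneg⟩ := hds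
      obtain ⟨e, ds, rfl⟩ := List.exists_cons_of_ne_nil hdne
      refine ⟨ℓs :: e :: ds, isNEStarData_iff.mpr ⟨by simp, ?_, ?_⟩, rfl, ?_⟩
      · intro x hx
        rcases List.mem_cons.mp hx with rfl | hx
        · exact ⟨hℓ, hex⟩
        · exact hdall x hx
      · intro x hx
        rcases List.mem_cons.mp hx with rfl | hx
        · exact hhead.trans_lt (hneg ms (by simp))
        · exact hdneg x hx
      · rw [neSteps, hsteps, ← List.append_assoc]
        rfl

/-! ## Tilde paths -/

theorem IsNETilde.isNEStar {l : List (ℤ × ℤ)} (h : IsNETilde l) : IsNEStar l := by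
  obtain ⟨hp, b, bs, hbs, -, hl⟩ := h
  exact ⟨hp, b, bs, hbs, hl⟩

theorem IsNEStar.exists_cons_isNETilde {l : List (ℤ × ℤ)} (h : IsNEStar l) :
    ∃ b, IsNETilde (interStep b :: l) := by
  obtain ⟨-, b, bs, hbs, rfl⟩ := h
  rw [isNEStarData_iff] at hbs
  obtain ⟨hne, hall, hneg⟩ := hbs
  obtain ⟨ℓs, r, rfl⟩ := List.exists_cons_of_ne_nil hne
  obtain ⟨hℓ, hex⟩ := hall ℓs (by simp)
  have hdata : IsNEStarData ((0 :: ℓs) :: r) := by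
    refine isNEStarData_iff.mpr ⟨by simp, fun x hx => ?_, hneg⟩
    rcases List.mem_cons.mp hx with rfl | hx
    · exact ⟨by simp, hex.zero_cons hℓ⟩
    · exact hall x (List.mem_cons_of_mem _ hx)
  have hsteps : neSteps b ((0 :: ℓs) :: r) = interStep b :: neSteps b (ℓs :: r) := by
    simp [neSteps, blockSteps_zero_cons b hℓ]
  exact ⟨b, hsteps ▸ hdata.isPrudent b, b, _, hdata, rfl, hsteps⟩

/-- The diagonal reflection, applied when the flag is set. -/
def reflectIf (e : Bool) (l : List (ℤ × ℤ)) : List (ℤ × ℤ) := if e then l.map Prod.swap else l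

theorem length_reflectIf (e : Bool) (l : List (ℤ × ℤ)) : (reflectIf e l).length = l.length := by
  cases e <;> simp [reflectIf]

theorem reflectIf_injective (e : Bool) : Function.Injective (reflectIf e) := by
  cases e
  · exact fun _ _ h => h
  · exact List.map_injective_iff.mpr Prod.swap_injective

theorem reflectIf_neSteps (b b' : Bool) (bs : List (List ℤ)) :
    reflectIf (b != b') (neSteps b bs) = neSteps b' bs := by
  cases b <;> cases b' <;> simp [reflectIf, map_swap_neSteps]

theorem IsNETilde.exists_append {l m : List (ℤ × ℤ)} (hl : IsNETilde l) (hm : IsNETilde m) :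
    ∃ e, IsNETilde (l ++ reflectIf e m) := by
  obtain ⟨-, b, bs, hbs, hbz, rfl⟩ := hl
  obtain ⟨-, c, cs, hcs, hcz, rfl⟩ := hm
  obtain ⟨b', hb'⟩ := hbs.exists_merge b
  obtain ⟨ds, hds, hdz, hsteps⟩ := hb' cs hcs hcz
  refine ⟨c != b', ?_⟩
  rw [reflectIf_neSteps, ← hsteps]
  exact ⟨hds.isPrudent b, b, ds, hds, hdz.trans hbz, rfl⟩

/-! ## The Hamiltonian -/

theorem dmid_append_of_lt {l m : List (ℤ × ℤ)} {i : ℕ} (h : i < l.length) :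
    dmid (l ++ m) i = dmid l i := by
  rw [dmid, dmid, pt_append_of_le h.le, pt_append_of_le h]

theorem dmid_append_length_add (l m : List (ℤ × ℤ)) (i : ℕ) :
    dmid (l ++ m) (l.length + i) = l.sum + l.sum + dmid m i := by
  rw [dmid, dmid, add_assoc, pt_append_length_add, pt_append_length_add, add_add_add_comm]

theorem Ham_add_le_Ham_append (l m : List (ℤ × ℤ)) : Ham l + Ham m ≤ Ham (l ++ m) := by
  unfold Ham
  let shift : ℕ × ℕ ↪ ℕ × ℕ := (addLeftEmbedding l.length).prodMap (addLeftEmbedding l.length)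
  rw [← Finset.card_map shift (s := Finset.filter _ (Finset.range m.length ×ˢ _)),
    ← Finset.card_union_of_disjoint]
  · refine Finset.card_le_card fun p hp => ?_
    simp only [Finset.mem_union, Finset.mem_map, Finset.mem_filter, Finset.mem_product,
      Finset.mem_range, List.length_append] at hp ⊢
    rcases hp with ⟨⟨h1, h2⟩, h3, h4⟩ | ⟨q, ⟨⟨h1, h2⟩, h3, h4⟩, rfl⟩
    · refine ⟨⟨by omega, by omega⟩, h3, ?_⟩
      rwa [dmid_append_of_lt h1, dmid_append_of_lt h2]
    · simp only [shift, Function.Embedding.coe_prodMap, addLeftEmbedding_apply, Prod.map_fst,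
        Prod.map_snd, dmid_append_length_add, add_sub_add_left_eq_sub]
      exact ⟨⟨by omega, by omega⟩, by omega, h4⟩
  · rw [Finset.disjoint_left]
    intro p hp hq
    simp only [Finset.mem_map, Finset.mem_filter, Finset.mem_product, Finset.mem_range] at hp hq
    obtain ⟨q, -, rfl⟩ := hq
    have := hp.1.1
    simp [shift] at this

theorem Ham_map_swap (l : List (ℤ × ℤ)) : Ham (l.map Prod.swap) = Ham l := by
  unfold Ham
  simp only [dmid, pt_map_swap, List.length_map]
  congr 1
  refine Finset.filter_congr fun p _ => and_congr_right fun _ => ?_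
  simp [add_comm]

theorem Ham_reflectIf (e : Bool) (l : List (ℤ × ℤ)) : Ham (reflectIf e l) = Ham l := by
  cases e
  · rfl
  · exact Ham_map_swap l

/-- All steps are unit steps. -/
def UnitSteps (l : List (ℤ × ℤ)) : Prop := ∀ d ∈ l, d ∈ Set.range dirs

theorem mem_range_dirs {d : ℤ × ℤ} :
    d ∈ Set.range dirs ↔ d = (1, 0) ∨ d = (-1, 0) ∨ d = (0, 1) ∨ d = (0, -1) := by
  simp only [dirs, Matrix.range_cons, Matrix.range_empty, Set.mem_union, Set.mem_singleton_iff,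
    Set.mem_empty_iff_false, or_false]

theorem pt_succ {l : List (ℤ × ℤ)} {i : ℕ} (h : i < l.length) : pt l (i + 1) = pt l i + l[i] := by
  rw [pt, pt, List.take_succ_eq_append_getElem h, List.sum_append, List.sum_singleton]

theorem IsPrudent.pt_succ_ne {l : List (ℤ × ℤ)} (hl : IsPrudent l) {i j : ℕ} (hij : i ≤ j)
    (hj : j < l.length) : pt l (j + 1) ≠ pt l i := by
  have := hl j hj 1 le_rfl i hij
  rwa [List.getD_eq_getElem _ _ hj, Nat.cast_one, one_smul, ← pt_succ hj] at this

theorem IsPrudent.dmid_ne {l : List (ℤ × ℤ)} (hl : IsPrudent l) (hu : UnitSteps l) {i j : ℕ}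
    (hij : i < j) (hj : j < l.length) : dmid l i ≠ dmid l j := by
  intro h
  have hi : i < l.length := hij.trans hj
  have h1 := hl.pt_succ_ne hij.le hj
  have h2 := hl.pt_succ_ne (Nat.succ_le_of_lt hij) hj
  have di := mem_range_dirs.mp (hu _ (List.getElem_mem hi))
  have dj := mem_range_dirs.mp (hu _ (List.getElem_mem hj))
  rw [dmid, dmid] at h
  simp only [Nat.succ_eq_add_one, pt_succ hi, pt_succ hj] at h h1 h2
  generalize pt l i = p at *
  generalize pt l j = q at *
  obtain ⟨p1, p2⟩ := p
  obtain ⟨q1, q2⟩ := q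
  rcases di with di | di | di | di <;> rcases dj with dj | dj | dj | dj <;>
    simp only [di, dj, Prod.mk_add_mk, Prod.mk.injEq, ne_eq, not_and] at h h1 h2 <;> omega

theorem IsPrudent.dmid_injOn {l : List (ℤ × ℤ)} (hl : IsPrudent l) (hu : UnitSteps l) :
    Set.InjOn (dmid l) (Set.Iio l.length) := by
  intro i hi j hj h
  rcases lt_trichotomy i j with hij | hij | hij
  · exact absurd h (hl.dmid_ne hu hij hj)
  · exact hij
  · exact absurd h.symm (hl.dmid_ne hu hij hi)

theorem eq_of_sq_add_sq_eq_four {a b : ℤ} (h : a ^ 2 + b ^ 2 = 4) :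
    (a, b) ∈ ({(2, 0), (-2, 0), (0, 2), (0, -2)} : Finset (ℤ × ℤ)) := by
  have ha : -2 ≤ a ∧ a ≤ 2 := by constructor <;> nlinarith [sq_nonneg b]
  have hb : -2 ≤ b ∧ b ≤ 2 := by constructor <;> nlinarith [sq_nonneg a]
  obtain ⟨ha1, ha2⟩ := ha
  obtain ⟨hb1, hb2⟩ := hb
  interval_cases a <;> interval_cases b <;> simp_all

theorem IsPrudent.Ham_le {l : List (ℤ × ℤ)} (hl : IsPrudent l) (hu : UnitSteps l) :
    Ham l ≤ 4 * l.length := by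
  unfold Ham
  calc _ ≤ (Finset.range l.length ×ˢ
        ({(2, 0), (-2, 0), (0, 2), (0, -2)} : Finset (ℤ × ℤ))).card := by
        refine Finset.card_le_card_of_injOn (fun p => (p.1, dmid l p.1 - dmid l p.2)) ?_ ?_
        · intro p hp
          simp only [Finset.coe_filter, Set.mem_ofPred_eq, Finset.mem_product] at hp
          exact Finset.mem_product.mpr ⟨hp.1.1, eq_of_sq_add_sq_eq_four hp.2.2⟩
        · rintro ⟨i, j⟩ hp ⟨i', j'⟩ hq h
          simp only [Finset.coe_filter, Set.mem_ofPred_eq, Finset.mem_product,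
            Finset.mem_range] at hp hq
          simp only [Prod.mk.injEq] at h
          obtain ⟨rfl, h⟩ := h
          rw [sub_right_inj] at h
          rw [hl.dmid_injOn hu hp.1.2 hq.1.2 h]
    _ = 4 * l.length := by
        rw [Finset.card_product, Finset.card_range, mul_comm]
        rfl

theorem dirs_injective : Function.Injective dirs := by
  decide

theorem unitSteps_stepsOf {L : ℕ} (s : Fin L → Fin 4) : UnitSteps (stepsOf s) := by
  intro d hd
  obtain ⟨k, -, rfl⟩ := List.mem_map.mp hd
  exact ⟨k, rfl⟩

theorem UnitSteps.append {l m : List (ℤ × ℤ)} (hl : UnitSteps l) (hm : UnitSteps m) :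
    UnitSteps (l ++ m) :=
  fun d hd => (List.mem_append.mp hd).elim (hl d) (hm d)

theorem UnitSteps.reflectIf {l : List (ℤ × ℤ)} (hl : UnitSteps l) (e : Bool) :
    UnitSteps (reflectIf e l) := by
  cases e
  · exact hl
  · intro d hd
    obtain ⟨c, hc, rfl⟩ := List.mem_map.mp hd
    have := mem_range_dirs.mp (hl c hc)
    rw [mem_range_dirs]
    rcases this with rfl | rfl | rfl | rfl <;> simp

theorem unitSteps_singleton_interStep (b : Bool) : UnitSteps [interStep b] := by
  intro d hd
  rw [List.mem_singleton.mp hd, mem_range_dirs]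
  cases b <;> simp [interStep]

/-! ## Partition functions as sums over lists of steps -/

theorem stepsOf_injective {L : ℕ} : Function.Injective (stepsOf (L := L)) :=
  (List.map_injective_iff.mpr dirs_injective).comp List.ofFn_injective

theorem length_stepsOf {L : ℕ} (s : Fin L → Fin 4) : (stepsOf s).length = L := by
  simp [stepsOf]

theorem UnitSteps.exists_stepsOf {l : List (ℤ × ℤ)} (hl : UnitSteps l) :
    ∃ s : Fin l.length → Fin 4, stepsOf s = l := by
  choose s hs using fun i : Fin l.length => hl l[i] (List.getElem_mem i.2)
  refine ⟨s, List.ext_getElem (length_stepsOf s) fun i hi hi' => ?_⟩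
  simpa [stepsOf] using hs ⟨i, hi'⟩

open scoped Classical in
/-- The `L`-step paths with property `P`, as lists of steps. -/
noncomputable def walkFinset (P : List (ℤ × ℤ) → Prop) (L : ℕ) : Finset (List (ℤ × ℤ)) :=
  (Finset.univ.filter fun s : Fin L → Fin 4 => P (stepsOf s)).image stepsOf

theorem mem_walkFinset {P : List (ℤ × ℤ) → Prop} {L : ℕ} {l : List (ℤ × ℤ)} :
    l ∈ walkFinset P L ↔ l.length = L ∧ UnitSteps l ∧ P l := by
  simp only [walkFinset, Finset.mem_image, Finset.mem_filter, Finset.mem_univ, true_and]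
  constructor
  · rintro ⟨s, hs, rfl⟩
    exact ⟨length_stepsOf s, unitSteps_stepsOf s, hs⟩
  · rintro ⟨rfl, hu, hP⟩
    obtain ⟨s, hs⟩ := hu.exists_stepsOf
    exact ⟨s, hs.symm ▸ hP, hs⟩

theorem card_walkFinset_le (P : List (ℤ × ℤ) → Prop) (L : ℕ) : (walkFinset P L).card ≤ 4 ^ L := by
  classical
  calc (walkFinset P L).card ≤ (Finset.univ : Finset (Fin L → Fin 4)).card :=
        Finset.card_image_le.trans (Finset.card_le_card (Finset.filter_subset _ _))
    _ = 4 ^ L := by simp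

/-- The Boltzmann weight of a path. -/
noncomputable def weight (β : ℝ) (l : List (ℤ × ℤ)) : ℝ := Real.exp (β * (Ham l : ℝ))

theorem Zstar_eq (β : ℝ) (L : ℕ) : Zstar β L = ∑ l ∈ walkFinset IsNEStar L, weight β l := by
  rw [walkFinset, Finset.sum_image stepsOf_injective.injOn]
  rfl

theorem Ztilde_eq (β : ℝ) (L : ℕ) : Ztilde β L = ∑ l ∈ walkFinset IsNETilde L, weight β l := by
  rw [walkFinset, Finset.sum_image stepsOf_injective.injOn]
  rfl

theorem weight_pos (β : ℝ) (l : List (ℤ × ℤ)) : 0 < weight β l := Real.exp_pos _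

theorem one_le_weight {β : ℝ} (hβ : 0 ≤ β) (l : List (ℤ × ℤ)) : 1 ≤ weight β l :=
  Real.one_le_exp (by positivity)

theorem weight_mul_weight_le {β : ℝ} (hβ : 0 ≤ β) (l m : List (ℤ × ℤ)) :
    weight β l * weight β m ≤ weight β (l ++ m) := by
  rw [weight, weight, weight, ← Real.exp_add, ← mul_add]
  have : ((Ham l : ℝ) + Ham m) ≤ Ham (l ++ m) := by exact_mod_cast Ham_add_le_Ham_append l m
  gcongr

theorem Finset.sum_le_sum_of_injOn_map {ι κ : Type*} {s : Finset ι} {t : Finset κ} (f : ι → κ)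
    {g : ι → ℝ} {h : κ → ℝ} (hf : ∀ x ∈ s, f x ∈ t) (hinj : Set.InjOn f s)
    (hgh : ∀ x ∈ s, g x ≤ h (f x)) (h0 : ∀ y ∈ t, 0 ≤ h y) :
    ∑ x ∈ s, g x ≤ ∑ y ∈ t, h y := by
  classical
  calc ∑ x ∈ s, g x ≤ ∑ x ∈ s, h (f x) := Finset.sum_le_sum hgh
    _ = ∑ y ∈ s.image f, h y := (Finset.sum_image hinj).symm
    _ ≤ ∑ y ∈ t, h y := Finset.sum_le_sum_of_subset_of_nonneg
        (Finset.image_subset_iff.mpr hf) fun y hy _ => h0 y hy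

theorem Ztilde_le_Zstar (β : ℝ) (L : ℕ) : Ztilde β L ≤ Zstar β L := by
  rw [Ztilde_eq, Zstar_eq]
  refine Finset.sum_le_sum_of_subset_of_nonneg (fun l hl => ?_) fun l _ _ => (weight_pos β l).le
  rw [mem_walkFinset] at hl ⊢
  exact ⟨hl.1, hl.2.1, hl.2.2.isNEStar⟩

theorem Zstar_le_Ztilde_succ {β : ℝ} (hβ : 0 ≤ β) (L : ℕ) : Zstar β L ≤ Ztilde β (L + 1) := by
  rw [Ztilde_eq, Zstar_eq]
  have hex (l : List (ℤ × ℤ)) : ∃ b, IsNEStar l → IsNETilde (interStep b :: l) := by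
    by_cases h : IsNEStar l
    · exact h.exists_cons_isNETilde.imp fun b hb _ => hb
    · exact ⟨true, fun h' => absurd h' h⟩
  choose b hb using hex
  refine Finset.sum_le_sum_of_injOn_map (fun l => interStep (b l) :: l) (fun l hl => ?_) ?_
    (fun l _ => ?_) fun l _ => (weight_pos β l).le
  · rw [mem_walkFinset] at hl ⊢
    exact ⟨by simp [hl.1], (unitSteps_singleton_interStep _).append hl.2.1, hb l hl.2.2⟩
  · exact fun l _ m _ h => (List.cons.inj h).2
  · calc weight β l ≤ weight β [interStep (b l)] * weight β l :=
          le_mul_of_one_le_left (weight_pos β l).le (one_le_weight hβ _)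
      _ ≤ weight β ([interStep (b l)] ++ l) := weight_mul_weight_le hβ _ _

theorem one_le_Zstar_succ {β : ℝ} (hβ : 0 ≤ β) (n : ℕ) : 1 ≤ Zstar β (n + 1) := by
  rw [Zstar_eq]
  have hdata : IsNEStarData [[(n + 1 : ℤ)]] := by
    refine isNEStarData_iff.mpr ⟨by simp, fun ℓs h => ?_, by simp⟩
    rw [List.mem_singleton] at h
    subst h
    refine ⟨by simp, fun i hi => ?_⟩
    obtain rfl : i = 0 := by simpa using hi
    simp
  have hsteps : neSteps true [[(n + 1 : ℤ)]] = List.replicate (n + 1) (0, 1) := by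
    have h0 : (0 : ℤ) ≤ n + 1 := by omega
    have habs : ((n : ℤ) + 1).natAbs = n + 1 := by omega
    simp [neSteps, blockSteps, weSteps_singleton, vrun, h0, habs]
  have hmem : List.replicate (n + 1) (0, 1) ∈ walkFinset IsNEStar (n + 1) := by
    refine mem_walkFinset.mpr ⟨by simp, fun d hd => ?_, hsteps ▸ hdata.isPrudent true, true, _,
      hdata, hsteps⟩
    rw [List.eq_of_mem_replicate hd, mem_range_dirs]
    simp
  exact (one_le_weight hβ _).trans
    (Finset.single_le_sum (f := weight β) (fun l _ => (weight_pos β l).le) hmem)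

theorem Ztilde_mul_Ztilde_le {β : ℝ} (hβ : 0 ≤ β) (m n : ℕ) :
    Ztilde β m * Ztilde β n ≤ 2 * Ztilde β (m + n) := by
  rw [Ztilde_eq, Ztilde_eq, Ztilde_eq, Finset.sum_mul_sum, ← Finset.sum_product']
  have hex (p : List (ℤ × ℤ) × List (ℤ × ℤ)) :
      ∃ e, IsNETilde p.1 → IsNETilde p.2 → IsNETilde (p.1 ++ reflectIf e p.2) := by
    by_cases h : IsNETilde p.1 ∧ IsNETilde p.2
    · exact (h.1.exists_append h.2).imp fun e he _ _ => he
    · exact ⟨true, fun h1 h2 => absurd ⟨h1, h2⟩ h⟩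
  choose e he using hex
  have htwo : 2 * ∑ l ∈ walkFinset IsNETilde (m + n), weight β l =
      ∑ q ∈ walkFinset IsNETilde (m + n) ×ˢ (Finset.univ : Finset Bool), weight β q.1 := by
    rw [Finset.sum_product, Finset.mul_sum]
    simp
  rw [htwo]
  refine Finset.sum_le_sum_of_injOn_map (fun p => (p.1 ++ reflectIf (e p) p.2, e p))
    (fun p hp => ?_) ?_ (fun p _ => ?_) fun q _ => (weight_pos β q.1).le
  · rw [Finset.mem_product, mem_walkFinset, mem_walkFinset] at hp
    obtain ⟨⟨h1, hu1, ht1⟩, h2, hu2, ht2⟩ := hp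
    refine Finset.mem_product.mpr ⟨mem_walkFinset.mpr ⟨?_, hu1.append (hu2.reflectIf _),
      he p ht1 ht2⟩, Finset.mem_univ _⟩
    rw [List.length_append, length_reflectIf, h1, h2]
  · intro p hp q hq h
    rw [Finset.mem_coe, Finset.mem_product, mem_walkFinset, mem_walkFinset] at hp hq
    obtain ⟨happ, hflag⟩ := Prod.mk.inj h
    obtain ⟨h1, h2⟩ := List.append_inj happ (hp.1.1.trans hq.1.1.symm)
    rw [hflag] at h2
    exact Prod.ext h1 (reflectIf_injective _ h2)
  · have := weight_mul_weight_le hβ p.1 (reflectIf (e p) p.2)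
    rwa [weight, weight, Ham_reflectIf] at this

theorem Ztilde_le {β : ℝ} (hβ : 0 ≤ β) (L : ℕ) :
    Ztilde β L ≤ Real.exp ((Real.log 4 + 4 * β) * L) := by
  have hw : ∀ l ∈ walkFinset IsNETilde L, weight β l ≤ Real.exp (4 * β * L) := by
    intro l hl
    obtain ⟨hlen, hu, hP⟩ := mem_walkFinset.mp hl
    have h : (Ham l : ℝ) ≤ 4 * L := by
      have := hP.1.Ham_le hu
      rw [hlen] at this
      exact_mod_cast this
    refine Real.exp_le_exp.mpr ?_
    nlinarith
  have hcard : ((walkFinset IsNETilde L).card : ℝ) ≤ 4 ^ L := by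
    exact_mod_cast card_walkFinset_le IsNETilde L
  calc Ztilde β L ≤ (walkFinset IsNETilde L).card • Real.exp (4 * β * L) := by
        rw [Ztilde_eq]
        exact Finset.sum_le_card_nsmul _ _ _ hw
    _ ≤ 4 ^ L * Real.exp (4 * β * L) := by
        rw [nsmul_eq_mul]
        gcongr
    _ = Real.exp ((Real.log 4 + 4 * β) * L) := by
        rw [add_mul, Real.exp_add, mul_comm (Real.log 4), Real.exp_nat_mul,
          Real.exp_log (by norm_num)]

/-! ## Free energies -/

/-- Fekete's lemma for sequences that are supermultiplicative up to a factor `2`. -/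
theorem exists_tendsto_log_div {M : ℕ → ℝ} (hone : ∀ n, 1 ≤ M n)
    (hmul : ∀ m n, M m * M n ≤ 2 * M (m + n)) {C : ℝ}
    (hle : ∀ n : ℕ, M n ≤ Real.exp (C * n)) :
    ∃ F, Tendsto (fun n : ℕ => Real.log (M n) / n) atTop (nhds F) := by
  have hpos n : 0 < M n := one_pos.trans_le (hone n)
  have hsub : Subadditive fun n => Real.log 2 - Real.log (M n) := by
    intro m n
    have := Real.log_le_log (mul_pos (hpos m) (hpos n)) (hmul m n)
    rw [Real.log_mul (hpos m).ne' (hpos n).ne', Real.log_mul two_ne_zero (hpos _).ne'] at this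
    linarith
  have hbdd : BddBelow (Set.range fun n : ℕ => (Real.log 2 - Real.log (M n)) / n) := by
    refine ⟨-|C|, ?_⟩
    rintro _ ⟨n, rfl⟩
    rcases Nat.eq_zero_or_pos n with rfl | hn
    · simp
    · have hn' : (0 : ℝ) < n := by exact_mod_cast hn
      have h1 : Real.log (M n) ≤ C * n := (Real.log_le_iff_le_exp (hpos n)).mpr (hle n)
      have h2 : 0 ≤ Real.log 2 := Real.log_nonneg one_le_two
      have h3 : C * n ≤ |C| * n := by gcongr; exact le_abs_self C
      simp only
      rw [le_div_iff₀ hn']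
      linarith
  refine ⟨0 - hsub.lim, ((tendsto_const_div_atTop_nhds_zero_nat (Real.log 2)).sub
    (hsub.tendsto_lim hbdd)).congr fun n => ?_⟩
  ring

theorem exists_tendsto_log_Ztilde {β : ℝ} (hβ : 0 ≤ β) :
    ∃ F, Tendsto (fun L : ℕ => Real.log (Ztilde β L) / L) atTop (nhds F) := by
  have hmono : Monotone (Ztilde β) := monotone_nat_of_le_succ fun n =>
    (Ztilde_le_Zstar β n).trans (Zstar_le_Ztilde_succ hβ n)
  have hmax : Monotone fun n => max (Ztilde β n) 1 := fun m n h => max_le_max_right 1 (hmono h)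
  have hone (n : ℕ) : 1 ≤ max (Ztilde β n) 1 := le_max_right _ _
  have hmul (m n : ℕ) :
      max (Ztilde β m) 1 * max (Ztilde β n) 1 ≤ 2 * max (Ztilde β (m + n)) 1 := by
    have hm := hmax (Nat.le_add_right m n)
    have hn := hmax (Nat.le_add_left n m)
    have h1 := hone (m + n)
    simp only at hm hn
    rcases le_total (Ztilde β m) 1 with h | h
    · rw [max_eq_right h]
      linarith
    rcases le_total (Ztilde β n) 1 with h' | h'
    · rw [max_eq_right h']
      linarith
    rw [max_eq_left h, max_eq_left h']
    exact (Ztilde_mul_Ztilde_le hβ m n).trans (by gcongr; exact le_max_left _ _)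
  have hle (n : ℕ) : max (Ztilde β n) 1 ≤ Real.exp ((Real.log 4 + 4 * β) * n) := by
    refine max_le (Ztilde_le hβ n) (Real.one_le_exp ?_)
    have : 0 ≤ Real.log 4 := Real.log_nonneg (by norm_num)
    positivity
  obtain ⟨F, hF⟩ := exists_tendsto_log_div hone hmul hle
  refine ⟨F, hF.congr' ?_⟩
  filter_upwards [eventually_ge_atTop 2] with n hn
  obtain ⟨k, rfl⟩ := Nat.exists_eq_add_of_le' hn
  rw [max_eq_left ((one_le_Zstar_succ hβ k).trans (Zstar_le_Ztilde_succ hβ (k + 1)))]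

/-- `Z^{NE,*}_{β,L−1} ≤ Z̃^{NE,*}_{β,L} ≤ Z^{NE,*}_{β,L}` for every `L ≥ 1`;
consequently the free energies of `Z^{NE,*}` and `Z̃^{NE,*}` both exist and
coincide. -/
theorem Zstar_Ztilde_comparison (β : ℝ) (hβ : 0 ≤ β) :
    (∀ L : ℕ, 1 ≤ L → Zstar β (L - 1) ≤ Ztilde β L ∧ Ztilde β L ≤ Zstar β L) ∧
    ∃ F : ℝ,
      Tendsto (fun L : ℕ => Real.log (Zstar β L) / (L : ℝ)) atTop (nhds F) ∧
      Tendsto (fun L : ℕ => Real.log (Ztilde β L) / (L : ℝ)) atTop (nhds F) := by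
  refine ⟨fun L hL => ⟨?_, Ztilde_le_Zstar β L⟩, ?_⟩
  · obtain ⟨n, rfl⟩ := Nat.exists_eq_add_of_le' hL
    exact Zstar_le_Ztilde_succ hβ n
  · obtain ⟨F, hF⟩ := exists_tendsto_log_Ztilde hβ
    refine ⟨F, ?_, hF⟩
    have hratio : Tendsto (fun L : ℕ => ((L + 1 : ℕ) : ℝ) / (L : ℝ)) atTop (nhds 1) := by
      have := tendsto_const_nhds (x := (1 : ℝ)).add (tendsto_const_div_atTop_nhds_zero_nat (1 : ℝ))
      rw [add_zero] at this
      refine this.congr' ?_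
      filter_upwards [eventually_ne_atTop 0] with L hL
      have : (L : ℝ) ≠ 0 := by exact_mod_cast hL
      push_cast
      field_simp
    have hshift : Tendsto (fun L : ℕ => Real.log (Ztilde β (L + 1)) / (L : ℝ)) atTop (nhds F) := by
      have := ((tendsto_add_atTop_iff_nat 1).mpr hF).mul hratio
      rw [mul_one] at this
      refine this.congr fun L => ?_
      have : ((L + 1 : ℕ) : ℝ) ≠ 0 := by positivity
      field_simp
    refine tendsto_of_tendsto_of_tendsto_of_le_of_le' hF hshift ?_ ?_
    · filter_upwards [eventually_ge_atTop 2] with L hL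
      obtain ⟨k, rfl⟩ := Nat.exists_eq_add_of_le' hL
      have hpos : 0 < Ztilde β (k + 2) := one_pos.trans_le
        ((one_le_Zstar_succ hβ k).trans (Zstar_le_Ztilde_succ hβ (k + 1)))
      gcongr
      exact Ztilde_le_Zstar β (k + 2)
    · filter_upwards [eventually_ge_atTop 1] with L hL
      obtain ⟨k, rfl⟩ := Nat.exists_eq_add_of_le' hL
      have hpos : 0 < Zstar β (k + 1) := one_pos.trans_le (one_le_Zstar_succ hβ k)
      gcongr
      exact Zstar_le_Ztilde_succ hβ (k + 1)
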